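/- Von Neumann-type inequality for the radial maximal Hardy space H^p: Let S_1,…,S_n be isometries with pairwise orthogonal ranges and vacuum vector ξ on a complex Hilbert space E, let p ≥ 1, and let a : F_n^+ → ℂ satisfy limsup_{k→∞}(∑_{|α|=k}|a_α|²)^{1/(2k)} ≤ 1. For 0 ≤ r < 1 write f(rS) := ∑_{k=0}^∞ r^k ∑_{|α|=k} a_α S_α (convergent in operator norm), and suppose ‖f‖_p := (∫₀¹ ‖f(rS)‖^p dr)^{1/p} < ∞. Then for every complex Hilbert space H and every n-tuple T of bounded operators on H with ‖T‖_row < 1, the series f(T) := ∑_{k=0}^∞ ∑_{|α|=k} a_α T_α converges in operator norm and ‖f(T)‖ ≤ (1 − ‖T‖_row)^{−1/p} · ‖f‖_p. -/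

import Mathlib

open Filter MeasureTheory
open scoped ENNReal

variable {n : ℕ}

/-- The operator `X_α` associated to a word `α` in the free monoid `F_n^+`
(words are encoded as lists over `Fin n`). -/
noncomputable def wordProd {H : Type*} [NormedAddCommGroup H] [NormedSpace ℂ H]
    (X : Fin n → H →L[ℂ] H) (α : List (Fin n)) : H →L[ℂ] H :=
  (α.map X).prod

/-- The level-`k` piece `∑_{|α|=k} a_α X_α` of a free power series (words of length `k`
are encoded as functions `Fin k → Fin n`). -/
noncomputable def lvlOp {H : Type*} [NormedAddCommGroup H] [NormedSpace ℂ H]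
    (a : List (Fin n) → ℂ) (X : Fin n → H →L[ℂ] H) (k : ℕ) : H →L[ℂ] H :=
  ∑ w : Fin k → Fin n, a (List.ofFn w) • wordProd X (List.ofFn w)

/-- `(∑_{|α|=k} |a_α|²)^{1/2}`. -/
noncomputable def lvlCoef (a : List (Fin n) → ℂ) (k : ℕ) : ℝ :=
  Real.sqrt (∑ w : Fin k → Fin n, ‖a (List.ofFn w)‖ ^ 2)

/-- `1/R = limsup_k (∑_{|α|=k} |a_α|²)^{1/(2k)}`, as an extended nonnegative real;
the radius of convergence is `(radiusInv a)⁻¹ ∈ [0,∞]`. -/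
noncomputable def radiusInv (a : List (Fin n) → ℂ) : ℝ≥0∞ :=
  Filter.limsup (fun k : ℕ => ENNReal.ofReal (lvlCoef a k ^ (1 / (2 * (k : ℝ))))) Filter.atTop

/-- The row norm `‖X_1X_1^* + ⋯ + X_nX_n^*‖^{1/2}`. -/
noncomputable def rowNorm {H : Type*} [NormedAddCommGroup H] [InnerProductSpace ℂ H]
    [CompleteSpace H] (X : Fin n → H →L[ℂ] H) : ℝ :=
  Real.sqrt ‖∑ i, X i ∘L ContinuousLinearMap.adjoint (X i)‖

/-- The joint spectral radius `limsup_k ‖∑_{|α|=k} X_α X_α^*‖^{1/(2k)}`,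
as an extended nonnegative real. -/
noncomputable def jsr {H : Type*} [NormedAddCommGroup H] [InnerProductSpace ℂ H]
    [CompleteSpace H] (X : Fin n → H →L[ℂ] H) : ℝ≥0∞ :=
  Filter.limsup (fun k : ℕ => ENNReal.ofReal
    (‖∑ w : Fin k → Fin n, wordProd X (List.ofFn w) ∘L
        ContinuousLinearMap.adjoint (wordProd X (List.ofFn w))‖ ^ (1 / (2 * (k : ℝ))))) Filter.atTop

open scoped InnerProductSpace

section helpers
open ContinuousLinearMap

variable {H : Type*} [NormedAddCommGroup H] [InnerProductSpace ℂ H] [CompleteSpace H]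

lemma mul_ap (A B : H →L[ℂ] H) (g : H) : (A * B) g = A (B g) := rfl

lemma adj_smul (c : ℂ) (A : H →L[ℂ] H) (g : H) :
    adjoint (c • A) g = (starRingEnd ℂ) c • adjoint A g := by
  rw [map_smulₛₗ]; rfl

lemma wp_nil (X : Fin n → H →L[ℂ] H) : wordProd X [] = 1 := by simp [wordProd]

lemma wp_cons (X : Fin n → H →L[ℂ] H) (i : Fin n) (α : List (Fin n)) :
    wordProd X (i :: α) = X i * wordProd X α := by simp [wordProd]

lemma wp_append (X : Fin n → H →L[ℂ] H) (α β : List (Fin n)) :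
    wordProd X (α ++ β) = wordProd X α * wordProd X β := by simp [wordProd]

lemma wp_smul (X : Fin n → H →L[ℂ] H) (c : ℂ) (α : List (Fin n)) :
    wordProd (fun i => c • X i) α = c ^ α.length • wordProd X α := by
  induction α with
  | nil => simp [wp_nil]
  | cons i α ih =>
    rw [wp_cons, wp_cons, ih, List.length_cons, pow_succ', smul_mul_smul_comm]

/-- `∑_{|α|=k} ‖X_α^* g‖²`. -/
noncomputable def lvlSq (X : Fin n → H →L[ℂ] H) (k : ℕ) (g : H) : ℝ :=
  ∑ w : Fin k → Fin n, ‖adjoint (wordProd X (List.ofFn w)) g‖ ^ 2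

lemma sum_words_succ {M : Type*} [AddCommMonoid M] (F : List (Fin n) → M) (k : ℕ) :
    ∑ w : Fin (k + 1) → Fin n, F (List.ofFn w)
      = ∑ i : Fin n, ∑ w : Fin k → Fin n, F (i :: List.ofFn w) := by
  rw [← Fintype.sum_prod_type' (fun i (w : Fin k → Fin n) => F (i :: List.ofFn w))]
  refine (Fintype.sum_equiv (Fin.consEquiv (fun _ => Fin n)) _ _ ?_).symm
  rintro ⟨i, w⟩
  simp [Fin.consEquiv, List.ofFn_succ]

lemma lvlSq_zero (X : Fin n → H →L[ℂ] H) (g : H) : lvlSq X 0 g = ‖g‖ ^ 2 := by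
  have : adjoint (1 : H →L[ℂ] H) = 1 := star_one _
  simp [lvlSq, wp_nil, this]

lemma adj_mul (A B : H →L[ℂ] H) (g : H) : adjoint (A * B) g = adjoint B (adjoint A g) := by
  have : adjoint (A * B) = adjoint B * adjoint A := star_mul A B
  rw [this]; rfl

lemma lvlSq_succ (X : Fin n → H →L[ℂ] H) (k : ℕ) (g : H) :
    lvlSq X (k + 1) g = ∑ i, lvlSq X k (adjoint (X i) g) := by
  unfold lvlSq
  rw [sum_words_succ (fun α => ‖adjoint (wordProd X α) g‖ ^ 2)]
  simp only [wp_cons, adj_mul]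

lemma lvlSq_le (X : Fin n → H →L[ℂ] H) (c : ℝ) (hc : 0 ≤ c)
    (hX : ∀ g, ∑ i, ‖adjoint (X i) g‖ ^ 2 ≤ c * ‖g‖ ^ 2) (k : ℕ) (g : H) :
    lvlSq X k g ≤ c ^ k * ‖g‖ ^ 2 := by
  induction k generalizing g with
  | zero => simp [lvlSq_zero]
  | succ k ih =>
    rw [lvlSq_succ]
    calc _ ≤ ∑ i, c ^ k * ‖adjoint (X i) g‖ ^ 2 := Finset.sum_le_sum fun i _ => ih _
      _ = c ^ k * ∑ i, ‖adjoint (X i) g‖ ^ 2 := by rw [Finset.mul_sum]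
      _ ≤ c ^ k * (c * ‖g‖ ^ 2) := by gcongr; exact hX g
      _ = _ := by ring

lemma lvlOp_norm_le (a : List (Fin n) → ℂ) (X : Fin n → H →L[ℂ] H) (ρ : ℝ) (hρ : 0 ≤ ρ)
    (hX : ∀ g, ∑ i, ‖adjoint (X i) g‖ ^ 2 ≤ ρ ^ 2 * ‖g‖ ^ 2) (k : ℕ) :
    ‖lvlOp a X k‖ ≤ lvlCoef a k * ρ ^ k := by
  have h0 : 0 ≤ lvlCoef a k := Real.sqrt_nonneg _
  rw [← (adjoint : (H →L[ℂ] H) ≃ₗᵢ⋆[ℂ] (H →L[ℂ] H)).norm_map (lvlOp a X k)]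
  refine ContinuousLinearMap.opNorm_le_bound _ (by positivity) fun g => ?_
  have : adjoint (lvlOp a X k) g = ∑ w : Fin k → Fin n,
      (starRingEnd ℂ) (a (List.ofFn w)) • adjoint (wordProd X (List.ofFn w)) g := by
    simp only [lvlOp, map_sum, sum_apply, adj_smul]
  rw [this]
  calc _ ≤ ∑ w : Fin k → Fin n, ‖a (List.ofFn w)‖ * ‖adjoint (wordProd X (List.ofFn w)) g‖ := by
        refine (norm_sum_le _ _).trans (le_of_eq ?_)
        simp [norm_smul]
    _ ≤ lvlCoef a k * √(lvlSq X k g) := Real.sum_mul_le_sqrt_mul_sqrt _ _ _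
    _ ≤ lvlCoef a k * (ρ ^ k * ‖g‖) := by
        gcongr
        apply Real.sqrt_le_iff.2 ⟨by positivity, ?_⟩
        refine (lvlSq_le X _ (by positivity) hX k g).trans (le_of_eq ?_)
        ring
    _ = _ := by ring

lemma sum_adj_eq (X : Fin n → H →L[ℂ] H) (g : H) :
    ((∑ i, ‖adjoint (X i) g‖ ^ 2 : ℝ) : ℂ) = ⟪g, (∑ i, X i ∘L adjoint (X i)) g⟫_ℂ := by
  rw [sum_apply, inner_sum, Complex.ofReal_sum]
  refine Finset.sum_congr rfl fun i _ => ?_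
  rw [ContinuousLinearMap.comp_apply, ← adjoint_inner_left, inner_self_eq_norm_sq_to_K]
  simp

lemma row_bound (X : Fin n → H →L[ℂ] H) (g : H) :
    ∑ i, ‖adjoint (X i) g‖ ^ 2 ≤ rowNorm X ^ 2 * ‖g‖ ^ 2 := by
  rw [rowNorm, Real.sq_sqrt (norm_nonneg _)]
  have h := congrArg norm (sum_adj_eq X g)
  rw [Complex.norm_real, Real.norm_of_nonneg (by positivity)] at h
  rw [h]
  refine (norm_inner_le_norm _ _).trans ?_
  calc _ ≤ ‖g‖ * (‖∑ i, X i ∘L adjoint (X i)‖ * ‖g‖) := by gcongr; exact le_opNorm _ _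
    _ = _ := by ring

lemma iso_bound (S : Fin n → H →L[ℂ] H)
    (hS : ∀ i j, adjoint (S i) ∘L S j = if i = j then 1 else 0) (g : H) :
    ∑ i, ‖adjoint (S i) g‖ ^ 2 ≤ ‖g‖ ^ 2 := by
  set y : H := (∑ i, S i ∘L adjoint (S i)) g with hy
  have h1 := sum_adj_eq S g
  rw [← hy] at h1
  have hSy : ∀ j, adjoint (S j) y = adjoint (S j) g := by
    intro j
    rw [hy, sum_apply, map_sum]
    have : ∀ i, adjoint (S j) ((S i ∘L adjoint (S i)) g)
        = if j = i then adjoint (S i) g else 0 := by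
      intro i
      have := congrArg (fun A : H →L[ℂ] H => A (adjoint (S i) g)) (hS j i)
      simp only [ContinuousLinearMap.comp_apply] at this ⊢
      rw [this]; split_ifs <;> simp
    simp only [this]
    simp
  have h2 : ((∑ i, ‖adjoint (S i) g‖ ^ 2 : ℝ) : ℂ) = ⟪y, y⟫_ℂ := by
    have h3 : ⟪y, y⟫_ℂ = ∑ i, ⟪adjoint (S i) y, adjoint (S i) g⟫_ℂ := by
      conv_lhs => rw [hy, sum_apply, inner_sum]
      rw [← sum_apply, ← hy]
      simp only [ContinuousLinearMap.comp_apply, adjoint_inner_left]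
    rw [h3, Complex.ofReal_sum]
    refine Finset.sum_congr rfl fun i _ => ?_
    rw [hSy, inner_self_eq_norm_sq_to_K]; simp
  rw [inner_self_eq_norm_sq_to_K] at h2
  have h2' : ∑ i, ‖adjoint (S i) g‖ ^ 2 = ‖y‖ ^ 2 := by
    apply Complex.ofReal_injective
    rw [h2]; simp
  have h := congrArg norm h1
  rw [Complex.norm_real, Real.norm_of_nonneg (by positivity), h2'] at h
  have h4 : ‖y‖ ^ 2 ≤ ‖g‖ * ‖y‖ := h ▸ norm_inner_le_norm _ _
  rw [h2']
  nlinarith [sq_nonneg (‖g‖ - ‖y‖)]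

/-- The tensor-type estimate. -/
lemma tensor_bound {ι E : Type*} [NormedAddCommGroup E] [InnerProductSpace ℂ E] [CompleteSpace E]
    (e : ι → E) (he : Orthonormal ℂ e) (A : E →L[ℂ] E) (k : ι → H) (s t : Finset ι) :
    ∑ β ∈ t, ‖∑ α ∈ s, ⟪A (e β), e α⟫_ℂ • k α‖ ^ 2 ≤ ‖A‖ ^ 2 * ∑ α ∈ s, ‖k α‖ ^ 2 := by
  classical
  let V : Submodule ℂ H := Submodule.span ℂ (s.image k : Set H)
  have : FiniteDimensional ℂ V := FiniteDimensional.span_finset ℂ _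
  let b := stdOrthonormalBasis ℂ V
  have hkV : ∀ α ∈ s, k α ∈ V := fun α hα =>
    Submodule.subset_span (by simpa using ⟨α, hα, rfl⟩)
  have hpars : ∀ v ∈ V, ‖v‖ ^ 2 = ∑ i, ‖⟪(b i : H), v⟫_ℂ‖ ^ 2 := by
    intro v hv
    have := b.sum_sq_norm_inner_right ⟨v, hv⟩
    simpa using this.symm
  have h1 : ∀ β ∈ t, ‖∑ α ∈ s, ⟪A (e β), e α⟫_ℂ • k α‖ ^ 2
      = ∑ i, ‖⟪e β, adjoint A (∑ α ∈ s, ⟪(b i : H), k α⟫_ℂ • e α)⟫_ℂ‖ ^ 2 := by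
    intro β _
    rw [hpars _ (V.sum_mem fun α hα => V.smul_mem _ (hkV α hα))]
    refine Finset.sum_congr rfl fun i _ => ?_
    rw [adjoint_inner_right, inner_sum, inner_sum]
    congr 2
    refine Finset.sum_congr rfl fun α _ => ?_
    rw [inner_smul_right, inner_smul_right, mul_comm]
  rw [Finset.sum_congr rfl h1, Finset.sum_comm]
  have h2 : ∀ α ∈ s, ‖k α‖ ^ 2 = ∑ i, ‖⟪(b i : H), k α⟫_ℂ‖ ^ 2 := fun α hα => hpars _ (hkV α hα)
  have h2' : ∑ α ∈ s, ‖k α‖ ^ 2 = ∑ i, ∑ α ∈ s, ‖⟪(b i : H), k α⟫_ℂ‖ ^ 2 := by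
    rw [Finset.sum_congr rfl h2, Finset.sum_comm]
  rw [h2', Finset.mul_sum]
  refine Finset.sum_le_sum fun i _ => ?_
  refine (Orthonormal.sum_inner_products_le (𝕜 := ℂ) (s := t) (adjoint A (∑ α ∈ s, ⟪(b i : H), k α⟫_ℂ • e α)) he).trans ?_
  have h3 : ‖∑ α ∈ s, ⟪(b i : H), k α⟫_ℂ • e α‖ ^ 2 = ∑ α ∈ s, ‖⟪(b i : H), k α⟫_ℂ‖ ^ 2 := by
    have := he.inner_sum (fun α => ⟪(b i : H), k α⟫_ℂ) (fun α => ⟪(b i : H), k α⟫_ℂ) s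
    rw [inner_self_eq_norm_sq_to_K] at this
    have h4 : ∀ z : ℂ, (starRingEnd ℂ) z * z = ((‖z‖ ^ 2 : ℝ) : ℂ) := by
      intro z; rw [mul_comm, Complex.mul_conj, Complex.normSq_eq_norm_sq]
    simp only [h4] at this
    rw [← Complex.ofReal_sum] at this
    apply Complex.ofReal_injective
    rw [← this]; simp
  rw [← h3, ← mul_pow]
  have h5 := le_opNorm (adjoint A) (∑ α ∈ s, ⟪(b i : H), k α⟫_ℂ • e α)
  rw [LinearIsometryEquiv.norm_map] at h5
  gcongr

lemma word_orthonormal (S : Fin n → H →L[ℂ] H)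
    (hS : ∀ i j, adjoint (S i) ∘L S j = if i = j then 1 else 0)
    (ξ : H) (hξ : ‖ξ‖ = 1) (hvac : ∀ i, adjoint (S i) ξ = 0) :
    Orthonormal ℂ (fun α : List (Fin n) => wordProd S α ξ) := by
  classical
  rw [orthonormal_iff_ite]
  intro α
  induction α with
  | nil =>
    intro β
    cases β with
    | nil => simp [wp_nil, inner_self_eq_norm_sq_to_K, hξ]
    | cons j β =>
      simp [wp_cons, wp_nil, ← adjoint_inner_left, hvac]
  | cons i α ih =>
    intro β
    cases β with
    | nil => simp [wp_cons, wp_nil, ← adjoint_inner_right, hvac]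
    | cons j β =>
      have := congrArg (fun A : H →L[ℂ] H => A (wordProd S β ξ)) (hS i j)
      simp only [ContinuousLinearMap.comp_apply] at this
      simp only [wp_cons, mul_ap, List.cons.injEq]
      rw [← adjoint_inner_right, this]
      by_cases hij : i = j
      · simp [hij, ih β]
      · simp [hij]

/-- The defect operator. -/
lemma exists_defect (X : Fin n → H →L[ℂ] H)
    (hX : ∀ g, ∑ i, ‖adjoint (X i) g‖ ^ 2 ≤ ‖g‖ ^ 2) :
    ∃ D : H →L[ℂ] H, ∀ g, ‖D g‖ ^ 2 = ‖g‖ ^ 2 - ∑ i, ‖adjoint (X i) g‖ ^ 2 := by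
  set Q : H →L[ℂ] H := 1 - ∑ i, X i ∘L adjoint (X i) with hQ
  have hin : ∀ g, ⟪g, Q g⟫_ℂ = ((‖g‖ ^ 2 - ∑ i, ‖adjoint (X i) g‖ ^ 2 : ℝ) : ℂ) := by
    intro g
    rw [Complex.ofReal_sub, sum_adj_eq, hQ, sub_apply, inner_sub_right]
    congr 1
    change ⟪g, g⟫_ℂ = _
    rw [inner_self_eq_norm_sq_to_K]; simp
  have hpos : 0 ≤ Q := by
    rw [ContinuousLinearMap.nonneg_iff_isPositive, ContinuousLinearMap.isPositive_iff_complex]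
    intro g
    have h : ⟪Q g, g⟫_ℂ = ((‖g‖ ^ 2 - ∑ i, ‖adjoint (X i) g‖ ^ 2 : ℝ) : ℂ) := by
      rw [← inner_conj_symm, hin, Complex.conj_ofReal]
    rw [h]
    have hre : RCLike.re ((‖g‖ ^ 2 - ∑ i, ‖adjoint (X i) g‖ ^ 2 : ℝ) : ℂ)
        = ‖g‖ ^ 2 - ∑ i, ‖adjoint (X i) g‖ ^ 2 := Complex.ofReal_re _
    rw [hre]
    exact ⟨rfl, sub_nonneg.2 (hX g)⟩
  refine ⟨CFC.sqrt Q, fun g => ?_⟩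
  have hsa : adjoint (CFC.sqrt Q) = CFC.sqrt Q := (CFC.sqrt_nonneg Q).isSelfAdjoint
  have hsq : CFC.sqrt Q * CFC.sqrt Q = Q := CFC.sqrt_mul_sqrt_self Q hpos
  have h := hin g
  rw [← hsq, mul_ap, ← adjoint_inner_left, hsa, inner_self_eq_norm_sq_to_K] at h
  apply Complex.ofReal_injective
  rw [← h]; simp

/-- words of length `k`. -/
noncomputable def lvlWords (n k : ℕ) : Finset (List (Fin n)) :=
  (Finset.univ : Finset (Fin k → Fin n)).map ⟨List.ofFn, List.ofFn_injective⟩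

lemma mem_lvlWords {k : ℕ} {α : List (Fin n)} : α ∈ lvlWords n k ↔ α.length = k := by
  simp only [lvlWords, Finset.mem_map, Finset.mem_univ, true_and, Function.Embedding.coeFn_mk]
  constructor
  · rintro ⟨w, rfl⟩; simp
  · rintro rfl; exact ⟨α.get, List.ofFn_get α⟩

lemma sum_lvlWords {M : Type*} [AddCommMonoid M] (k : ℕ) (F : List (Fin n) → M) :
    ∑ α ∈ lvlWords n k, F α = ∑ w : Fin k → Fin n, F (List.ofFn w) := by
  simp [lvlWords]

/-- words of length `< m`. -/
noncomputable def ballWords (n m : ℕ) : Finset (List (Fin n)) :=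
  (Finset.range m).biUnion (lvlWords n)

lemma mem_ballWords {m : ℕ} {α : List (Fin n)} : α ∈ ballWords n m ↔ α.length < m := by
  simp [ballWords, mem_lvlWords]

lemma sum_ballWords {M : Type*} [AddCommMonoid M] (m : ℕ) (F : List (Fin n) → M) :
    ∑ α ∈ ballWords n m, F α
      = ∑ k ∈ Finset.range m, ∑ w : Fin k → Fin n, F (List.ofFn w) := by
  rw [ballWords, Finset.sum_biUnion]
  · simp only [sum_lvlWords]
  · intro i _ j _ hij
    refine Finset.disjoint_left.2 fun α h1 h2 => hij ?_
    rw [mem_lvlWords] at h1 h2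
    omega

lemma lvlSq_succ_right (X : Fin n → H →L[ℂ] H) (k : ℕ) (g : H) :
    lvlSq X (k + 1) g = ∑ w : Fin k → Fin n, ∑ i,
      ‖adjoint (X i) (adjoint (wordProd X (List.ofFn w)) g)‖ ^ 2 := by
  induction k generalizing g with
  | zero =>
    have : adjoint (1 : H →L[ℂ] H) = 1 := star_one _
    rw [lvlSq_succ]; simp [lvlSq_zero, wp_nil, this]
  | succ k ih =>
    rw [lvlSq_succ, sum_words_succ (fun α => ∑ i, ‖adjoint (X i) (adjoint (wordProd X α) g)‖ ^ 2)]
    simp only [ih, wp_cons, adj_mul]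

lemma defect_sum (X : Fin n → H →L[ℂ] H) (D : H →L[ℂ] H)
    (hD : ∀ g, ‖D g‖ ^ 2 = ‖g‖ ^ 2 - ∑ i, ‖adjoint (X i) g‖ ^ 2) (m : ℕ) (g : H) :
    ∑ α ∈ ballWords n m, ‖D (adjoint (wordProd X α) g)‖ ^ 2 = ‖g‖ ^ 2 - lvlSq X m g := by
  rw [sum_ballWords]
  induction m with
  | zero => simp [lvlSq_zero]
  | succ m ih =>
    rw [Finset.sum_range_succ, ih, lvlSq_succ_right]
    simp only [hD, Finset.sum_sub_distrib]
    rw [lvlSq]; ring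

/-- von Neumann inequality for polynomials. -/
lemma vN_poly {E : Type*} [NormedAddCommGroup E] [InnerProductSpace ℂ E] [CompleteSpace E]
    (S : Fin n → E →L[ℂ] E)
    (hS : ∀ i j, adjoint (S i) ∘L S j = if i = j then 1 else 0)
    (ξ : E) (hξ : ‖ξ‖ = 1) (hvac : ∀ i, adjoint (S i) ξ = 0)
    (X : Fin n → H →L[ℂ] H) (c : ℝ) (hc0 : 0 ≤ c) (hc1 : c < 1)
    (hX : ∀ g, ∑ i, ‖adjoint (X i) g‖ ^ 2 ≤ c * ‖g‖ ^ 2)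
    (b : List (Fin n) → ℂ) (P : Finset (List (Fin n))) :
    ‖∑ γ ∈ P, b γ • wordProd X γ‖ ≤ ‖∑ γ ∈ P, b γ • wordProd S γ‖ := by
  classical
  set A := ∑ γ ∈ P, b γ • wordProd S γ with hA
  set f := ∑ γ ∈ P, b γ • wordProd X γ with hf
  have hX1 : ∀ g, ∑ i, ‖adjoint (X i) g‖ ^ 2 ≤ ‖g‖ ^ 2 := fun g =>
    (hX g).trans (mul_le_of_le_one_left (by positivity) hc1.le)
  obtain ⟨D, hD⟩ := exists_defect X hX1
  have he := word_orthonormal S hS ξ hξ hvac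
  have he' := orthonormal_iff_ite.1 he
  obtain ⟨d, hd⟩ : ∃ d, ∀ γ ∈ P, γ.length < d :=
    ⟨P.sup List.length + 1, fun γ hγ => Nat.lt_succ_of_le (Finset.le_sup hγ)⟩
  rw [← (adjoint : (H →L[ℂ] H) ≃ₗᵢ⋆[ℂ] (H →L[ℂ] H)).norm_map f]
  refine ContinuousLinearMap.opNorm_le_bound _ (norm_nonneg _) fun g => ?_
  set v := adjoint f g with hv
  have hv' : v = ∑ γ ∈ P, (starRingEnd ℂ) (b γ) • adjoint (wordProd X γ) g := by
    simp only [hv, hf, map_sum, sum_apply, adj_smul]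
  have key : ∀ m, ‖v‖ ^ 2 - lvlSq X m v ≤ ‖A‖ ^ 2 * ‖g‖ ^ 2 := by
    intro m
    have h := tensor_bound _ he A (fun α => D (adjoint (wordProd X α) g))
      (ballWords n (m + d)) (ballWords n m)
    rw [defect_sum X D hD (m + d) g] at h
    have h0 : 0 ≤ lvlSq X (m + d) g := Finset.sum_nonneg fun _ _ => by positivity
    have h1 : ‖A‖ ^ 2 * (‖g‖ ^ 2 - lvlSq X (m + d) g) ≤ ‖A‖ ^ 2 * ‖g‖ ^ 2 := by
      gcongr; linarith
    rw [← defect_sum X D hD m v]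
    refine le_trans (le_of_eq ?_) (h.trans h1)
    refine Finset.sum_congr rfl fun β hβ => ?_
    congr 2
    have h2 : ∀ α, ⟪A (wordProd S β ξ), wordProd S α ξ⟫_ℂ
        = ∑ γ ∈ P, if γ ++ β = α then (starRingEnd ℂ) (b γ) else 0 := by
      intro α
      rw [hA, sum_apply, sum_inner]
      refine Finset.sum_congr rfl fun γ _ => ?_
      rw [smul_apply, inner_smul_left, ← mul_ap,
        ← wp_append, he']
      simp
    simp only [h2, Finset.sum_smul, ite_smul, zero_smul]
    rw [Finset.sum_comm, hv', map_sum, map_sum]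
    refine Finset.sum_congr rfl fun γ hγ => ?_
    rw [Finset.sum_ite_eq, if_pos, wp_append, adj_mul, map_smul, map_smul]
    rw [mem_ballWords] at hβ ⊢
    have := hd γ hγ
    simp; omega
  have hlim : Tendsto (fun m => ‖v‖ ^ 2 - lvlSq X m v) atTop (nhds (‖v‖ ^ 2 - 0)) := by
    refine tendsto_const_nhds.sub ?_
    refine squeeze_zero (fun m => Finset.sum_nonneg fun _ _ => by positivity)
      (fun m => lvlSq_le X c hc0 hX m v) ?_
    simpa using (tendsto_pow_atTop_nhds_zero_of_lt_one hc0 hc1).mul_const (‖v‖ ^ 2)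
  have := le_of_tendsto' hlim key
  rw [sub_zero, ← mul_pow] at this
  exact le_of_sq_le_sq this (by positivity)

lemma coef_summable (a : List (Fin n) → ℂ) (ha : radiusInv a ≤ 1) (ρ : ℝ) (hρ : 0 ≤ ρ)
    (hρ1 : ρ < 1) : Summable (fun k => lvlCoef a k * ρ ^ k) := by
  obtain ⟨t, ht1, ht2⟩ : ∃ t : ℝ, 1 < t ∧ t ^ 2 * ρ < 1 := by
    have hcont : Tendsto (fun t : ℝ => t ^ 2 * ρ) (nhdsWithin 1 (Set.Ioi 1)) (nhds (1 ^ 2 * ρ)) :=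
      ((continuous_pow 2).mul continuous_const).continuousAt.mono_left nhdsWithin_le_nhds
    have h1 := hcont.eventually (gt_mem_nhds (by simpa using hρ1 : (1:ℝ) ^ 2 * ρ < 1))
    obtain ⟨t, h, h'⟩ := (h1.and self_mem_nhdsWithin).exists
    exact ⟨t, h', h⟩
  have hlt : radiusInv a < ENNReal.ofReal t :=
    lt_of_le_of_lt ha (by simpa using (ENNReal.one_lt_ofReal.2 ht1))
  have hev := Filter.eventually_lt_of_limsup_lt hlt
  have hnn : ∀ k, 0 ≤ lvlCoef a k := fun k => Real.sqrt_nonneg _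
  refine summable_of_isBigO_nat (summable_geometric_of_lt_one (by positivity) ht2) ?_
  refine Asymptotics.IsBigO.of_bound 1 ?_
  filter_upwards [hev, eventually_gt_atTop 0] with k hk hk0
  have hkR : (0 : ℝ) < k := by exact_mod_cast hk0
  have hk' := (ENNReal.ofReal_lt_ofReal_iff (by linarith)).1 hk
  have h2 : lvlCoef a k ≤ (t ^ 2) ^ k := by
    have h3 : lvlCoef a k = (lvlCoef a k ^ (1 / (2 * (k : ℝ)))) ^ (2 * k) := by
      rw [← Real.rpow_natCast, ← Real.rpow_mul (hnn k)]
      push_cast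
      rw [one_div_mul_cancel (by positivity), Real.rpow_one]
    rw [h3, ← pow_mul]
    exact pow_le_pow_left₀ (Real.rpow_nonneg (hnn k) _) hk'.le _
  have := hnn k
  rw [Real.norm_of_nonneg (by positivity), Real.norm_of_nonneg (by positivity), one_mul, mul_pow]
  gcongr

end helpers

/-- **Von Neumann-type inequality for the radial maximal Hardy space `H^p`.** Let `p ≥ 1`,
let `a` satisfy the Hadamard bound `limsup ≤ 1`, and suppose
`‖f‖_p := (∫₀¹ ‖f(rS)‖^p dr)^{1/p} < ∞` (i.e. `r ↦ ‖f(rS)‖^p` is integrable on `(0,1]`).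
Then for every tuple `T` with `‖T‖_row < 1` the series `f(T)` converges in operator norm
and `‖f(T)‖ ≤ (1 − ‖T‖_row)^{−1/p} ‖f‖_p`. -/
theorem stmt_19 {n : ℕ} (hn : 0 < n)
    {E : Type*} [NormedAddCommGroup E] [InnerProductSpace ℂ E] [CompleteSpace E]
    (S : Fin n → E →L[ℂ] E)
    (hS : ∀ i j, ContinuousLinearMap.adjoint (S i) ∘L S j = if i = j then 1 else 0)
    (ξ : E) (hξ : ‖ξ‖ = 1) (hvac : ∀ i, ContinuousLinearMap.adjoint (S i) ξ = 0)
    (p : ℝ) (hp : 1 ≤ p) (a : List (Fin n) → ℂ) (ha : radiusInv a ≤ 1)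
    (hInt : MeasureTheory.IntegrableOn
      (fun r : ℝ => ‖∑' k : ℕ, ((r : ℂ) ^ k) • lvlOp a S k‖ ^ p) (Set.Ioc 0 1))
    {H : Type*} [NormedAddCommGroup H] [InnerProductSpace ℂ H] [CompleteSpace H]
    (T : Fin n → H →L[ℂ] H) (hT : rowNorm T < 1) :
    Summable (fun k : ℕ => ‖lvlOp a T k‖) ∧
    ‖∑' k : ℕ, lvlOp a T k‖ ≤
      (1 - rowNorm T) ^ (-(1 / p)) *
        (∫ r in Set.Ioc (0 : ℝ) 1,
          ‖∑' k : ℕ, ((r : ℂ) ^ k) • lvlOp a S k‖ ^ p) ^ (1 / p) := by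
  have hρ0 : 0 ≤ rowNorm T := Real.sqrt_nonneg _
  set ρ := rowNorm T with hρ
  have hsT : Summable (fun k : ℕ => ‖lvlOp a T k‖) :=
    Summable.of_nonneg_of_le (fun _ => norm_nonneg _)
      (fun k => lvlOp_norm_le a T ρ hρ0 (row_bound T) k) (coef_summable a ha ρ hρ0 hT)
  refine ⟨hsT, ?_⟩
  have hle : ∀ r ∈ Set.Ioo ρ 1, ‖∑' k : ℕ, lvlOp a T k‖
      ≤ ‖∑' k : ℕ, ((r : ℂ) ^ k) • lvlOp a S k‖ := by
    rintro r ⟨hr, hr1⟩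
    have hr0 : 0 < r := hρ0.trans_lt hr
    have hsS : Summable (fun k : ℕ => ((r : ℂ) ^ k) • lvlOp a S k) := by
      refine Summable.of_norm (Summable.of_nonneg_of_le (fun _ => norm_nonneg _) (fun k => ?_)
        (coef_summable a ha r hr0.le hr1))
      have := lvlOp_norm_le a S 1 zero_le_one (by simpa using iso_bound S hS) k
      rw [norm_smul, norm_pow, Complex.norm_real, Real.norm_of_nonneg hr0.le, mul_comm]
      gcongr
      simpa using this
    have ht1 := hsT.of_norm.hasSum.tendsto_sum_nat.norm
    have ht2 := hsS.hasSum.tendsto_sum_nat.norm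
    refine le_of_tendsto_of_tendsto' ht1 ht2 fun m => ?_
    have hrC : (r : ℂ) ≠ 0 := by exact_mod_cast hr0.ne'
    have hv := vN_poly S hS ξ hξ hvac (fun i => (r : ℂ)⁻¹ • T i) ((ρ / r) ^ 2) (by positivity)
      (by
        have : ρ / r < 1 := (div_lt_one hr0).2 hr
        exact pow_lt_one₀ (by positivity) this two_ne_zero)
      (by
        intro g
        have h := row_bound T g
        have h1 : ∀ i, ‖ContinuousLinearMap.adjoint ((r : ℂ)⁻¹ • T i) g‖ ^ 2
            = (r⁻¹) ^ 2 * ‖ContinuousLinearMap.adjoint (T i) g‖ ^ 2 := by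
          intro i
          rw [adj_smul, norm_smul, mul_pow]
          simp
        simp only [h1, ← Finset.mul_sum]
        calc _ ≤ (r⁻¹) ^ 2 * (rowNorm T ^ 2 * ‖g‖ ^ 2) := by gcongr
          _ = _ := by rw [← hρ]; ring)
      (fun α => (r : ℂ) ^ α.length * a α) (ballWords n m)
    simp only [wp_smul, sum_ballWords] at hv
    have e1 : ∀ k, (∑ w : Fin k → Fin n, ((r : ℂ) ^ (List.ofFn w).length * a (List.ofFn w)) •
        ((r : ℂ)⁻¹ ^ (List.ofFn w).length • wordProd T (List.ofFn w))) = lvlOp a T k := by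
      intro k
      refine Finset.sum_congr rfl fun w _ => ?_
      rw [smul_smul]
      congr 1
      rw [inv_pow]
      field_simp
    have e2 : ∀ k, (∑ w : Fin k → Fin n, ((r : ℂ) ^ (List.ofFn w).length * a (List.ofFn w)) •
        wordProd S (List.ofFn w)) = (r : ℂ) ^ k • lvlOp a S k := by
      intro k
      rw [lvlOp, Finset.smul_sum]
      refine Finset.sum_congr rfl fun w _ => ?_
      rw [smul_smul, List.length_ofFn]
    simpa only [e1, e2] using hv
  have hp0 : 0 < p := by linarith
  set N := ‖∑' k : ℕ, lvlOp a T k‖ with hN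
  have hN0 : 0 ≤ N := norm_nonneg _
  set I := ∫ r in Set.Ioc (0 : ℝ) 1, ‖∑' k : ℕ, ((r : ℂ) ^ k) • lvlOp a S k‖ ^ p with hI
  have hsub : Set.Ioo ρ 1 ⊆ Set.Ioc 0 1 := fun r hr => ⟨hρ0.trans_lt hr.1, hr.2.le⟩
  have h1 : (1 - ρ) * N ^ p ≤ I := by
    have hc : ∫ r in Set.Ioo ρ 1, N ^ p = (1 - ρ) * N ^ p := by
      rw [setIntegral_const, smul_eq_mul, Real.volume_real_Ioo_of_le hT.le]
    rw [← hc]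
    refine le_trans (setIntegral_mono_on (by simp) (hInt.mono_set hsub) measurableSet_Ioo
      (fun r hr => Real.rpow_le_rpow hN0 (hle r hr) hp0.le)) ?_
    exact setIntegral_mono_set hInt
      (ae_of_all _ fun r => Real.rpow_nonneg (norm_nonneg _) _) hsub.eventuallyLE
  have hd : 0 < 1 - ρ := by linarith
  have h2 : N ^ p ≤ (1 - ρ)⁻¹ * I := by
    rw [inv_mul_eq_div, le_div_iff₀ hd]; linarith
  have hI0 : 0 ≤ I := le_trans (by positivity) h1
  calc N = (N ^ p) ^ (1 / p) := by
        rw [← Real.rpow_mul hN0, mul_one_div_cancel hp0.ne', Real.rpow_one]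
    _ ≤ ((1 - ρ)⁻¹ * I) ^ (1 / p) := Real.rpow_le_rpow (by positivity) h2 (by positivity)
    _ = _ := by
      rw [Real.mul_rpow (by positivity) hI0, Real.inv_rpow hd.le, Real.rpow_neg hd.le]
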